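/- arXiv:math/9307215 — 2 statements merged into one kernel-verified Lean document; each statement's English description precedes it below -/
import Mathlib

section
/- Let X be a p×np real matrix and T an np×np real matrix such that S = col(XT^l)_{l=0}^{n-1} is invertible, and let V_1,...,V_n be the np×p block columns of S^{-1}. Define the monic p×p matrix polynomial Q̂(x) = x^n·I − X·T^n·(V_1 + V_2·x + ... + V_n·x^{n-1}). Then, as an identity of np×p matrix polynomials, V_n·Q̂(x) = (x·I − T)·(V_1 + V_2·x + ... + V_n·x^{n-1}). -/
open Matrix

/-- The `np × np` block matrix `S = col(X Tˡ)_{l=0}^{n-1}` whose `l`-th block row is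
`X Tˡ` (the `np`-dimensional index set is realized as `Fin n × Fin p`). -/
noncomputable def colStd {p n : ℕ} (X : Matrix (Fin p) (Fin n × Fin p) ℝ)
    (T : Matrix (Fin n × Fin p) (Fin n × Fin p) ℝ) :
    Matrix (Fin n × Fin p) (Fin n × Fin p) ℝ :=
  Matrix.of fun lr c => (X * T ^ (lr.1 : ℕ)) lr.2 c

/-- The `np × p` block columns `V₁, …, Vₙ` of `S⁻¹`: `Vstd X T j` is `V_{j+1}`. -/
noncomputable def Vstd {p n : ℕ} (X : Matrix (Fin p) (Fin n × Fin p) ℝ)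
    (T : Matrix (Fin n × Fin p) (Fin n × Fin p) ℝ) (j : Fin n) :
    Matrix (Fin n × Fin p) (Fin p) ℝ :=
  Matrix.of fun a c => (colStd X T)⁻¹ a (j, c)

theorem colStd_mul_apply {p n : ℕ} {q : Type*} (X : Matrix (Fin p) (Fin n × Fin p) ℝ)
    (T : Matrix (Fin n × Fin p) (Fin n × Fin p) ℝ) (A : Matrix (Fin n × Fin p) q ℝ)
    (l : Fin n) (r : Fin p) (c : q) :
    (colStd X T * A) (l, r) c = (X * T ^ (l : ℕ) * A) r c := rfl

theorem eq_of_forall_mul_pow_mul_eq {p n : ℕ} {q : Type*}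
    {X : Matrix (Fin p) (Fin n × Fin p) ℝ}
    {T : Matrix (Fin n × Fin p) (Fin n × Fin p) ℝ} (hS : IsUnit (colStd X T))
    {A B : Matrix (Fin n × Fin p) q ℝ}
    (h : ∀ l : Fin n, X * T ^ (l : ℕ) * A = X * T ^ (l : ℕ) * B) : A = B := by
  have hdet : IsUnit (colStd X T).det := (Matrix.isUnit_iff_isUnit_det _).1 hS
  have hAB : colStd X T * A = colStd X T * B := by
    ext ⟨l, r⟩ c
    rw [colStd_mul_apply, colStd_mul_apply, h]
  rw [← Matrix.nonsing_inv_mul_cancel_left (colStd X T) A hdet, hAB,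
    Matrix.nonsing_inv_mul_cancel_left (colStd X T) B hdet]

theorem mul_pow_mul_Vstd {p n : ℕ} {X : Matrix (Fin p) (Fin n × Fin p) ℝ}
    {T : Matrix (Fin n × Fin p) (Fin n × Fin p) ℝ} (hS : IsUnit (colStd X T))
    (l j : Fin n) :
    X * T ^ (l : ℕ) * Vstd X T j = if l = j then 1 else 0 := by
  ext r c
  have hdet : IsUnit (colStd X T).det := (Matrix.isUnit_iff_isUnit_det _).1 hS
  have h : (X * T ^ (l : ℕ) * Vstd X T j) r c =
      (colStd X T * (colStd X T)⁻¹) (l, r) (j, c) := rfl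
  rw [h, Matrix.mul_nonsing_inv _ hdet, Matrix.one_apply]
  by_cases hlj : l = j <;> simp [hlj, Matrix.one_apply]

theorem mul_pow_mul_sum_Vstd {p n : ℕ} {X : Matrix (Fin p) (Fin n × Fin p) ℝ}
    {T : Matrix (Fin n × Fin p) (Fin n × Fin p) ℝ} (hS : IsUnit (colStd X T))
    (x : ℝ) {l : ℕ} (hl : l < n) :
    X * T ^ l * ∑ j : Fin n, x ^ (j : ℕ) • Vstd X T j = x ^ l • 1 := by
  have h := mul_pow_mul_Vstd hS ⟨l, hl⟩
  simp only at h
  simp [Matrix.mul_sum, h]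

/-- For a pair `(X, T)` with `S = col(X Tˡ)_{l=0}^{n-1}` invertible,
`S⁻¹ = (V₁ ⋯ Vₙ)`, and the associated monic matrix polynomial
`Q̂(x) = xⁿ I − X Tⁿ (V₁ + V₂ x + ⋯ + Vₙ xⁿ⁻¹)`, the identity
`Vₙ Q̂(x) = (x I − T)(V₁ + V₂ x + ⋯ + Vₙ xⁿ⁻¹)` of `np × p` matrix polynomials
holds. -/
theorem standard_pair_resolvent_identity {p n : ℕ} (hn : 0 < n)
    (X : Matrix (Fin p) (Fin n × Fin p) ℝ)
    (T : Matrix (Fin n × Fin p) (Fin n × Fin p) ℝ)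
    (hS : IsUnit (colStd X T)) :
    ∀ x : ℝ,
      Vstd X T ⟨n - 1, Nat.sub_lt hn one_pos⟩ *
          (x ^ n • (1 : Matrix (Fin p) (Fin p) ℝ) -
            X * T ^ n * ∑ j : Fin n, x ^ (j : ℕ) • Vstd X T j) =
        (x • (1 : Matrix (Fin n × Fin p) (Fin n × Fin p) ℝ) - T) *
          ∑ j : Fin n, x ^ (j : ℕ) • Vstd X T j := by
  intro x
  refine eq_of_forall_mul_pow_mul_eq hS fun l => ?_
  have hV := mul_pow_mul_Vstd hS l ⟨n - 1, Nat.sub_lt hn one_pos⟩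
  have hW := mul_pow_mul_sum_Vstd hS x l.isLt
  set W := ∑ j : Fin n, x ^ (j : ℕ) • Vstd X T j
  have hR : X * T ^ (l : ℕ) * ((x • 1 - T) * W) =
      x ^ ((l : ℕ) + 1) • 1 - X * T ^ ((l : ℕ) + 1) * W := by
    rw [Matrix.sub_mul, Matrix.mul_sub, Matrix.smul_mul, Matrix.one_mul, Matrix.mul_smul, hW,
      smul_smul, ← pow_succ', pow_succ T]
    simp only [Matrix.mul_assoc]
  rw [hR, ← Matrix.mul_assoc, hV]
  by_cases hl : (l : ℕ) + 1 = n
  · rw [if_pos (Fin.ext (by simp only; omega)), Matrix.one_mul, hl]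
  · have hlt : (l : ℕ) + 1 < n := by omega
    rw [if_neg (fun h => hl (by rw [h]; simp only; omega)), Matrix.zero_mul,
      mul_pow_mul_sum_Vstd hS x hlt, sub_self]
end

section
/- Let W be a weight matrix function on a finite interval [a,b], (P_n)_{n≥0} a sequence of orthonormal matrix polynomials with respect to W, and n ≥ 1. If x_i and x_j are distinct zeros of P_n with rootvectors v and w respectively (i.e., v, w ≠ 0, P_n(x_i)·v = 0 and P_n(x_j)·w = 0), then v^T·(Σ_{l=0}^{n-1} P_l(x_i)^T·P_l(x_j))·w = 0. -/
open Polynomial Matrix MeasureTheory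

/-- Evaluation of a `p × p` matrix polynomial at a real number `x`
(entrywise evaluation, i.e. evaluation at the scalar matrix `x • 1`). -/
noncomputable def mev {p : ℕ} (P : Polynomial (Matrix (Fin p) (Fin p) ℝ)) (x : ℝ) :
    Matrix (Fin p) (Fin p) ℝ :=
  P.eval (x • (1 : Matrix (Fin p) (Fin p) ℝ))

/-- Entrywise integral of a matrix-valued function over `[a, b]`. -/
noncomputable def mInt {p : ℕ} (a b : ℝ) (F : ℝ → Matrix (Fin p) (Fin p) ℝ) :
    Matrix (Fin p) (Fin p) ℝ :=
  Matrix.of fun i j => ∫ x in a..b, F x i j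

/-- `W` is a weight matrix function on `[a, b]`: it takes symmetric values on `[a, b]`,
is measurable and (entrywise) integrable on `[a, b]`, is positive semidefinite almost
everywhere on `[a, b]`, and has nonzero determinant almost everywhere on `[a, b]`. -/
def IsWeight (p : ℕ) (a b : ℝ) (W : ℝ → Matrix (Fin p) (Fin p) ℝ) : Prop :=
  (∀ x ∈ Set.Icc a b, (W x).IsSymm) ∧
  (∀ i j, Measurable fun x => W x i j) ∧
  (∀ i j, IntervalIntegrable (fun x => W x i j) volume a b) ∧
  (∀ᵐ x ∂volume.restrict (Set.Icc a b), (W x).PosSemidef) ∧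
  (∀ᵐ x ∂volume.restrict (Set.Icc a b), (W x).det ≠ 0)

/-- `P` is a sequence of orthonormal matrix polynomials with respect to the weight
matrix `W` on `[a, b]`: `deg Pₙ = n`, the leading coefficients are invertible,
`P₀ = I` and `∫_a^b Pₙ(x) W(x) Pₘ(x)ᵀ dx = δₙₘ I`. -/
def IsOrthonormal (p : ℕ) (a b : ℝ) (W : ℝ → Matrix (Fin p) (Fin p) ℝ)
    (P : ℕ → Polynomial (Matrix (Fin p) (Fin p) ℝ)) : Prop :=
  (∀ n, (P n).natDegree = n) ∧ (∀ n, IsUnit (P n).leadingCoeff) ∧ P 0 = 1 ∧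
  ∀ n m : ℕ,
    mInt a b (fun x => mev (P n) x * W x * (mev (P m) x)ᵀ) =
      if n = m then 1 else 0

/-- Polynomials of degree less than `N` are combinations, with constant coefficients on the left,
of the first `N` members of a sequence of polynomials of exact degrees `0, 1, 2, …` with
invertible leading coefficients. -/
lemma exists_eq_sum_C_mul_of_coeff_eq_zero {R : Type*} [Ring R] {P : ℕ → Polynomial R}
    (hdeg : ∀ n, (P n).natDegree = n) (hlead : ∀ n, IsUnit (P n).leadingCoeff) (N : ℕ)
    (Q : Polynomial R) (hQ : ∀ k, N ≤ k → Q.coeff k = 0) :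
    ∃ c : ℕ → R, Q = ∑ m ∈ Finset.range N, C (c m) * P m := by
  induction N generalizing Q with
  | zero => exact ⟨0, by ext k; simpa using hQ k (Nat.zero_le k)⟩
  | succ N ih =>
    obtain ⟨u, hu⟩ := hlead N
    have hu' : (P N).coeff N = u := by rw [hu, leadingCoeff, hdeg]
    obtain ⟨c, hc⟩ := ih (Q - C (Q.coeff N * ↑u⁻¹) * P N) (by
      intro k hk
      rw [coeff_sub, coeff_C_mul]
      rcases hk.eq_or_lt with rfl | hk
      · simp [hu']
      · rw [hQ k hk, coeff_eq_zero_of_natDegree_lt (p := P N) (by rwa [hdeg])]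
        simp)
    refine ⟨Function.update c N (Q.coeff N * ↑u⁻¹), ?_⟩
    rw [Finset.sum_range_succ, Function.update_self, ← sub_eq_iff_eq_add, hc]
    refine Finset.sum_congr rfl fun m hm => ?_
    rw [Function.update_of_ne (Finset.mem_range.mp hm).ne]

lemma mev_mul_X {p : ℕ} (P : Polynomial (Matrix (Fin p) (Fin p) ℝ)) (x : ℝ) :
    mev (P * X) x = x • mev P x := by
  simp [mev]

lemma mev_sum_C_mul {p : ℕ} (s : Finset ℕ) (c : ℕ → Matrix (Fin p) (Fin p) ℝ)
    (P : ℕ → Polynomial (Matrix (Fin p) (Fin p) ℝ)) (x : ℝ) :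
    mev (∑ m ∈ s, C (c m) * P m) x = ∑ m ∈ s, c m * mev (P m) x := by
  simp [mev, eval_finsetSum]

lemma continuous_mev {p : ℕ} (P : Polynomial (Matrix (Fin p) (Fin p) ℝ)) :
    Continuous (mev P) := by
  unfold mev
  simp only [eval_eq_sum_range]
  fun_prop

lemma intervalIntegrable_fun_sum {ι : Type*} {a b : ℝ} (s : Finset ι) {f : ι → ℝ → ℝ}
    (h : ∀ i ∈ s, IntervalIntegrable (f i) volume a b) :
    IntervalIntegrable (fun x => ∑ i ∈ s, f i x) volume a b := by
  simpa only [Finset.sum_fn] using IntervalIntegrable.sum s h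

/-- Entrywise integrability over `[a, b]` is preserved by multiplication on both sides by
continuous matrix functions. -/
lemma intervalIntegrable_mul_mul {p : ℕ} {a b : ℝ} {W F G : ℝ → Matrix (Fin p) (Fin p) ℝ}
    (hW : ∀ i j, IntervalIntegrable (fun x => W x i j) volume a b)
    (hF : Continuous F) (hG : Continuous G) (i j : Fin p) :
    IntervalIntegrable (fun x => (F x * W x * G x) i j) volume a b := by
  simp only [Matrix.mul_apply]
  refine intervalIntegrable_fun_sum _ fun k _ => ?_
  refine IntervalIntegrable.mul_continuousOn ?_ (hG.matrix_elem k j).continuousOn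
  exact intervalIntegrable_fun_sum _ fun l _ => (hW l k).continuousOn_mul (hF.matrix_elem i l).continuousOn

lemma mInt_sum_mul {p : ℕ} {a b : ℝ} (s : Finset ℕ) (c : ℕ → Matrix (Fin p) (Fin p) ℝ)
    (F : ℕ → ℝ → Matrix (Fin p) (Fin p) ℝ)
    (hF : ∀ m i j, IntervalIntegrable (fun x => F m x i j) volume a b) :
    mInt a b (fun x => ∑ m ∈ s, c m * F m x) = ∑ m ∈ s, c m * mInt a b (F m) := by
  ext i j
  simp only [mInt, Matrix.of_apply, Matrix.sum_apply, Matrix.mul_apply]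
  rw [intervalIntegral.integral_finsetSum fun m _ =>
    intervalIntegrable_fun_sum _ fun k _ => (hF m k j).const_mul (c m i k)]
  refine Finset.sum_congr rfl fun m _ => ?_
  rw [intervalIntegral.integral_finsetSum fun k _ => (hF m k j).const_mul _]
  simp only [intervalIntegral.integral_const_mul]

lemma mInt_transpose {p : ℕ} (a b : ℝ) (F : ℝ → Matrix (Fin p) (Fin p) ℝ) :
    (mInt a b F)ᵀ = mInt a b fun x => (F x)ᵀ := rfl

/-- The coefficients of an expansion in orthonormal matrix polynomials are the Fourier
coefficients. -/
lemma IsOrthonormal.mInt_sum_C_mul {p : ℕ} {a b : ℝ} {W : ℝ → Matrix (Fin p) (Fin p) ℝ}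
    {P : ℕ → Polynomial (Matrix (Fin p) (Fin p) ℝ)} (hP : IsOrthonormal p a b W P)
    (hW : ∀ i j, IntervalIntegrable (fun x => W x i j) volume a b)
    {s : Finset ℕ} (c : ℕ → Matrix (Fin p) (Fin p) ℝ) {m : ℕ} (hm : m ∈ s) :
    mInt a b (fun x => mev (∑ k ∈ s, C (c k) * P k) x * W x * (mev (P m) x)ᵀ) = c m := by
  simp only [mev_sum_C_mul, Finset.sum_mul, Matrix.mul_assoc]
  simp only [← Matrix.mul_assoc (mev _ _)]
  rw [mInt_sum_mul s c (fun k x => mev (P k) x * W x * (mev (P m) x)ᵀ) fun k =>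
    intervalIntegrable_mul_mul hW (continuous_mev _) (continuous_mev _).matrix_transpose]
  simp [hP.2.2.2, hm]

/-- The conjugate coefficients appear when the expansion stands in the second slot. -/
lemma IsOrthonormal.mInt_sum_C_mul_right {p : ℕ} {a b : ℝ} {W : ℝ → Matrix (Fin p) (Fin p) ℝ}
    {P : ℕ → Polynomial (Matrix (Fin p) (Fin p) ℝ)} (hP : IsOrthonormal p a b W P)
    (hW : ∀ i j, IntervalIntegrable (fun x => W x i j) volume a b)
    {s : Finset ℕ} (c : ℕ → Matrix (Fin p) (Fin p) ℝ) {m : ℕ} (hm : m ∈ s) :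
    mInt a b (fun x => mev (P m) x * W x * (mev (∑ k ∈ s, C (c k) * P k) x)ᵀ) = (c m)ᵀ := by
  have hP' : IsOrthonormal p a b (fun x => (W x)ᵀ) P := by
    refine ⟨hP.1, hP.2.1, hP.2.2.1, fun k l => ?_⟩
    have h := congrArg transpose (hP.2.2.2 l k)
    rw [mInt_transpose] at h
    simp only [Matrix.transpose_mul, Matrix.transpose_transpose, ← Matrix.mul_assoc] at h
    rw [h]
    by_cases hkl : k = l
    · simp [hkl]
    · simp [hkl, Ne.symm hkl]
  rw [← hP'.mInt_sum_C_mul (fun i j => hW j i) c hm, mInt_transpose]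
  simp only [Matrix.transpose_mul, Matrix.transpose_transpose, Matrix.mul_assoc]

/-- Rootvectors corresponding to distinct zeros of the orthonormal matrix polynomial
`Pₙ` are "orthogonal" with respect to the kernel: if `v, w ≠ 0`, `Pₙ(x_i) v = 0`,
`Pₙ(x_j) w = 0` and `x_i ≠ x_j`, then `vᵀ (∑_{l=0}^{n-1} P_l(x_i)ᵀ P_l(x_j)) w = 0`. -/
theorem rootvectors_kernel_orthogonal {p : ℕ} (a b : ℝ)
    (W : ℝ → Matrix (Fin p) (Fin p) ℝ) (hW : IsWeight p a b W)
    (P : ℕ → Polynomial (Matrix (Fin p) (Fin p) ℝ))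
    (hP : IsOrthonormal p a b W P)
    (n : ℕ) (hn : 1 ≤ n) (xi xj : ℝ) (hne : xi ≠ xj)
    (v w : Fin p → ℝ) (hv : v ≠ 0) (hw : w ≠ 0)
    (hvker : mev (P n) xi *ᵥ v = 0) (hwker : mev (P n) xj *ᵥ w = 0) :
    v ⬝ᵥ ((∑ l ∈ Finset.range n, (mev (P l) xi)ᵀ * mev (P l) xj) *ᵥ w) = 0 := by
  have hWi := hW.2.2.1
  have hexp : ∀ l, ∃ c : ℕ → Matrix (Fin p) (Fin p) ℝ, l < n →
      P l * X = ∑ m ∈ Finset.range (n + 1), C (c m) * P m := by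
    intro l
    by_cases hl : l < n
    · obtain ⟨c, hc⟩ := exists_eq_sum_C_mul_of_coeff_eq_zero hP.1 hP.2.1 (n + 1) (P l * X) (by
        intro k hk
        obtain ⟨k, rfl⟩ : ∃ k', k = k' + 1 := ⟨k - 1, by omega⟩
        rw [coeff_mul_X]
        exact coeff_eq_zero_of_natDegree_lt (by rw [hP.1]; omega))
      exact ⟨c, fun _ => hc⟩
    · exact ⟨0, fun h => absurd h hl⟩
  choose A hA using hexp
  have hsymm : ∀ l < n, ∀ m < n, A l m = (A m l)ᵀ := by
    intro l hl m hm
    rw [← hP.mInt_sum_C_mul hWi (A l) (Finset.mem_range.mpr (hm.trans n.lt_succ_self)),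
      ← hP.mInt_sum_C_mul_right hWi (A m) (Finset.mem_range.mpr (hl.trans n.lt_succ_self)),
      ← hA l hl, ← hA m hm]
    simp only [mev_mul_X, Matrix.transpose_smul, Matrix.smul_mul, Matrix.mul_smul]
  have hrec : ∀ (x : ℝ) (u : Fin p → ℝ), mev (P n) x *ᵥ u = 0 → ∀ l < n,
      x • (mev (P l) x *ᵥ u) = ∑ m ∈ Finset.range n, A l m *ᵥ (mev (P m) x *ᵥ u) := by
    intro x u hu l hl
    rw [← Matrix.smul_mulVec, ← mev_mul_X, hA l hl, mev_sum_C_mul, Matrix.sum_mulVec,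
      Finset.sum_range_succ]
    simp only [← Matrix.mulVec_mulVec, hu, Matrix.mulVec_zero, add_zero]
  have hS : v ⬝ᵥ ((∑ l ∈ Finset.range n, (mev (P l) xi)ᵀ * mev (P l) xj) *ᵥ w) =
      ∑ l ∈ Finset.range n, (mev (P l) xi *ᵥ v) ⬝ᵥ (mev (P l) xj *ᵥ w) := by
    rw [Matrix.sum_mulVec, dotProduct_sum]
    refine Finset.sum_congr rfl fun l _ => ?_
    rw [← Matrix.mulVec_mulVec, Matrix.dotProduct_mulVec, Matrix.vecMul_transpose]
  rw [hS]
  have key : xi * ∑ l ∈ Finset.range n, (mev (P l) xi *ᵥ v) ⬝ᵥ (mev (P l) xj *ᵥ w) =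
      xj * ∑ l ∈ Finset.range n, (mev (P l) xi *ᵥ v) ⬝ᵥ (mev (P l) xj *ᵥ w) := by
    calc _ = ∑ l ∈ Finset.range n, ∑ m ∈ Finset.range n,
          (A l m *ᵥ (mev (P m) xi *ᵥ v)) ⬝ᵥ (mev (P l) xj *ᵥ w) := by
          rw [Finset.mul_sum]
          refine Finset.sum_congr rfl fun l hl => ?_
          rw [← smul_eq_mul, ← smul_dotProduct, hrec xi v hvker l (Finset.mem_range.mp hl),
            sum_dotProduct]
      _ = ∑ m ∈ Finset.range n, ∑ l ∈ Finset.range n,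
          (mev (P m) xi *ᵥ v) ⬝ᵥ (A m l *ᵥ (mev (P l) xj *ᵥ w)) := by
          rw [Finset.sum_comm]
          refine Finset.sum_congr rfl fun m hm => Finset.sum_congr rfl fun l hl => ?_
          rw [hsymm l (Finset.mem_range.mp hl) m (Finset.mem_range.mp hm),
            Matrix.mulVec_transpose, ← Matrix.dotProduct_mulVec]
      _ = _ := by
          rw [Finset.mul_sum]
          refine Finset.sum_congr rfl fun m hm => ?_
          rw [← smul_eq_mul, ← dotProduct_smul, hrec xj w hwker m (Finset.mem_range.mp hm),
            dotProduct_sum]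
  by_contra h
  exact hne (mul_right_cancel₀ h key)
end
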